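/- Let d ≥ 2 and let S be a cap in F₂^d with |S| = 2^(d−1). Then there exists a nonzero linear functional f : F₂^d → F₂ such that S = {v ∈ F₂^d : f(v) = 1}. (In design language: saturated regular designs of resolution IV are unique up to isomorphism and are even designs.) -/

import Mathlib

-- A design with N = 2^d runs and n factors is a Finset of nonzero vectors of F₂^d.
-- The double D(S) ⊆ F₂^(d+1) consists of the vectors (v,0) and (v,1) for v ∈ S,
-- where (v,ε) appends the coordinate ε to v.
def double {d : ℕ} (S : Finset (Fin d → ZMod 2)) : Finset (Fin (d + 1) → ZMod 2) :=
  S.image (fun v => Fin.snoc v 0) ∪ S.image (fun v => Fin.snoc v 1)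

-- The t-fold iterated double.
def iterDouble {d : ℕ} (S : Finset (Fin d → ZMod 2)) : (t : ℕ) → Finset (Fin (d + t) → ZMod 2)
  | 0 => S
  | t + 1 => double (iterDouble S t)

-- m_S(v): the number of unordered pairs {a, b} of distinct elements of S with a + b = v
-- (the number of two-factor interactions in the alias set corresponding to v).
def mcount {d : ℕ} (S : Finset (Fin d → ZMod 2)) (v : Fin d → ZMod 2) : ℕ :=
  ((S.powersetCard 2).filter (fun T => T.sum id = v)).card

-- B_j(S): the number of j-element subsets of S summing to zero
-- (the number of defining words of length j).
def wordCount {d : ℕ} (S : Finset (Fin d → ZMod 2)) (j : ℕ) : ℕ :=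
  ((S.powersetCard j).filter (fun T => T.sum id = 0)).card

-- S is a cap: a set of nonzero vectors no three distinct elements of which sum to zero
-- (i.e. the corresponding design has resolution at least IV).
def IsCap {d : ℕ} (S : Finset (Fin d → ZMod 2)) : Prop :=
  (∀ v ∈ S, v ≠ 0) ∧
    ∀ a ∈ S, ∀ b ∈ S, ∀ c ∈ S, a ≠ b → b ≠ c → a ≠ c → a + b + c ≠ 0

-- S is a maximal cap: no nonzero vector outside S can be added keeping it a cap.
def IsMaximalCap {d : ℕ} (S : Finset (Fin d → ZMod 2)) : Prop :=
  IsCap S ∧ ∀ w : Fin d → ZMod 2, w ≠ 0 → w ∉ S → ¬ IsCap (insert w S)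

-- The 2^{5-1} design with defining relation I = ABCDE, as a subset of F₂⁴.

/-- The sum of two elements of a cap lies outside the cap. -/
theorem IsCap.add_notMem {d : ℕ} {S : Finset (Fin d → ZMod 2)} (hS : IsCap S)
    {a b : Fin d → ZMod 2} (ha : a ∈ S) (hb : b ∈ S) : a + b ∉ S := by
  intro hab
  have ha0 := hS.1 a ha
  have hb0 := hS.1 b hb
  have hne : a ≠ b := by
    rintro rfl
    exact hS.1 _ hab (ZModModule.add_self a)
  exact hS.2 a ha b hb (a + b) hab hne (by simpa using ha0) (by simpa using hb0)
    (ZModModule.add_self (a + b))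

/-- Translation by an element of a cap of maximum size maps the complement into the cap. -/
theorem IsCap.add_mem_of_notMem {d : ℕ} (hd : 1 ≤ d) {S : Finset (Fin d → ZMod 2)}
    (hS : IsCap S) (hsize : S.card = 2 ^ (d - 1)) {a v : Fin d → ZMod 2}
    (ha : a ∈ S) (hv : v ∉ S) : a + v ∈ S := by
  have hsub : S.map (addLeftEmbedding a) ⊆ Sᶜ := by
    intro x hx
    obtain ⟨b, hb, rfl⟩ := Finset.mem_map.1 hx
    exact Finset.mem_compl.2 (hS.add_notMem ha hb)
  have hcard : Sᶜ.card ≤ (S.map (addLeftEmbedding a)).card := by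
    rw [Finset.card_map, Finset.card_compl, Fintype.card_fun, ZMod.card, Fintype.card_fin, hsize]
    obtain ⟨k, rfl⟩ := Nat.exists_eq_add_of_le' hd
    simp only [Nat.add_sub_cancel, pow_succ]
    omega
  have hmem : v ∈ S.map (addLeftEmbedding a) := by
    rw [Finset.eq_of_subset_of_card_le hsub hcard]
    exact Finset.mem_compl.2 hv
  obtain ⟨b, hb, rfl⟩ := Finset.mem_map.1 hmem
  simpa [← add_assoc, ZModModule.add_self a] using hb

-- A cap of the maximum size 2^(d-1) in F₂^d (d ≥ 2) is exactly {v : f v = 1} for some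
-- nonzero linear functional f (saturated resolution IV designs are unique up to isomorphism).
theorem saturated_cap_structure (d : ℕ) (hd : 2 ≤ d) (S : Finset (Fin d → ZMod 2))
    (hcap : IsCap S) (hsize : S.card = 2 ^ (d - 1)) :
    ∃ f : (Fin d → ZMod 2) →ₗ[ZMod 2] ZMod 2, f ≠ 0 ∧ ∀ v, v ∈ S ↔ f v = 1 := by
  classical
  have hadd : ∀ u v, (if u + v ∈ S then (1 : ZMod 2) else 0) =
      (if u ∈ S then 1 else 0) + (if v ∈ S then 1 else 0) := by
    intro u v
    by_cases hu : u ∈ S <;> by_cases hv : v ∈ S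
    · simp [hu, hv, hcap.add_notMem hu hv, CharTwo.add_self_eq_zero]
    · simp [hu, hv, hcap.add_mem_of_notMem (by omega) hsize hu hv]
    · simp [hu, hv, add_comm u v, hcap.add_mem_of_notMem (by omega) hsize hv hu]
    · have huv : u + v ∉ S := by
        intro h
        have := hcap.add_mem_of_notMem (by omega) hsize h hv
        rw [add_assoc, ZModModule.add_self v, add_zero] at this
        exact hu this
      simp [hu, hv, huv]
  let f : (Fin d → ZMod 2) →ₗ[ZMod 2] ZMod 2 :=
    (AddMonoidHom.mk' (fun v => if v ∈ S then (1 : ZMod 2) else 0) hadd).toZModLinearMap 2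
  have hf : ∀ v, v ∈ S ↔ f v = 1 := by
    intro v
    change v ∈ S ↔ (if v ∈ S then (1 : ZMod 2) else 0) = 1
    simp
  obtain ⟨a, ha⟩ : S.Nonempty := Finset.card_pos.1 (by rw [hsize]; positivity)
  refine ⟨f, fun h0 => ?_, hf⟩
  have := (hf a).1 ha
  simp [h0] at this
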